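/- Let P be a noiseless, finitely supported probability distribution on 𝒳 × {-1,1}, and partition the support of P_X as 𝒳₊ = {x : P_X(x) > 0, P(Y=1|X=x) = 1} and 𝒳₋ = {x : P_X(x) > 0, P(Y=-1|X=x) = 1}. If f : 𝒳 → [-1,1] is a lossless maximal compressor of P, then there exist values s₊, s₋ ∈ [-1,1] with s₊ ≠ s₋ such that f(x) = s₊ for all x ∈ 𝒳₊ and f(x) = s₋ for all x ∈ 𝒳₋. -/

import Mathlib

open Finset

noncomputable section

/-- The binary label space `𝒴 = {-1, 1} ⊆ ℤ`. -/
abbrev Ybin : Type := ({-1, 1} : Finset ℤ)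

/-- The label `+1` as an element of `Ybin`. -/
def yPos : Ybin := ⟨1, by decide⟩

/-- The label `-1` as an element of `Ybin`. -/
def yNeg : Ybin := ⟨-1, by decide⟩

/-- Probability of a set under a finitely supported pmf `P`. -/
def pr {Ω : Type*} [Fintype Ω] (P : Ω → ℝ) (s : Set Ω) : ℝ :=
  ∑ ω, s.indicator P ω

/-- Entropy `H_P(A)` of a random variable `A` (a function of the sample point),
`H_P(A) = -∑_a P(A=a) log P(A=a)`, written as a sum over sample points. -/
def ent {Ω α : Type*} [Fintype Ω] (P : Ω → ℝ) (A : Ω → α) : ℝ :=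
  -∑ ω, P ω * Real.log (pr P {ω' | A ω' = A ω})

/-- Conditional entropy `H_P(A|B) = -∑_{a,b} P(A=a,B=b) log P(A=a|B=b)`. -/
def condEnt {Ω α β : Type*} [Fintype Ω] (P : Ω → ℝ) (A : Ω → α) (B : Ω → β) : ℝ :=
  -∑ ω, P ω * Real.log (pr P {ω' | A ω' = A ω ∧ B ω' = B ω} / pr P {ω' | B ω' = B ω})

/-- Mutual information `I_P(A;B) = ∑_{a,b} P(A=a,B=b) log (P(A=a,B=b) / (P(A=a) P(B=b)))`. -/
def mi {Ω α β : Type*} [Fintype Ω] (P : Ω → ℝ) (A : Ω → α) (B : Ω → β) : ℝ :=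
  ∑ ω, P ω * Real.log (pr P {ω' | A ω' = A ω ∧ B ω' = B ω} /
      (pr P {ω' | A ω' = A ω} * pr P {ω' | B ω' = B ω}))

/-- Marginal `P_X(x) = ∑_y P(x,y)`. -/
def margX {𝒳 : Type*} [Fintype 𝒳] (P : 𝒳 × Ybin → ℝ) (x : 𝒳) : ℝ :=
  ∑ y, P (x, y)

/-- Risk `R_P(h) = P[sign(h(X)) ≠ Y]`. -/
def risk {𝒳 : Type*} [Fintype 𝒳] (P : 𝒳 × Ybin → ℝ) (h : 𝒳 → ℝ) : ℝ :=
  pr P {ω | Real.sign (h ω.1) ≠ ((ω.2 : ℤ) : ℝ)}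


section Entropy

variable {Ω α β : Type*} [Fintype Ω] {P : Ω → ℝ}

lemma pr_pos (hP : ∀ ω, 0 ≤ P ω) {s : Set Ω} {ω : Ω} (hs : ω ∈ s) (hω : 0 < P ω) :
    0 < pr P s :=
  Finset.sum_pos' (fun i _ => Set.indicator_nonneg (fun j _ => hP j) i)
    ⟨ω, Finset.mem_univ ω, by rwa [Set.indicator_of_mem hs]⟩

lemma pr_mono (hP : ∀ ω, 0 ≤ P ω) {s t : Set Ω} (h : s ⊆ t) : pr P s ≤ pr P t :=
  Finset.sum_le_sum fun i _ => Set.indicator_le_indicator_of_subset h hP i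

lemma pr_congr {s t : Set Ω} (h : ∀ ω, P ω ≠ 0 → (ω ∈ s ↔ ω ∈ t)) : pr P s = pr P t := by
  classical
  refine Finset.sum_congr rfl fun i _ => ?_
  by_cases hi : P i = 0
  · simp [Set.indicator_apply, hi]
  · simp [Set.indicator_apply, h i hi]

lemma mem_of_pr_eq (hP : ∀ ω, 0 ≤ P ω) {s t : Set Ω} (h : s ⊆ t) (hst : pr P s = pr P t)
    {ω : Ω} (hω : 0 < P ω) (ht : ω ∈ t) : ω ∈ s := by
  by_contra hs
  have key := (Finset.sum_eq_sum_iff_of_le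
    fun i _ => Set.indicator_le_indicator_of_subset h hP i).1 hst ω (Finset.mem_univ ω)
  rw [Set.indicator_of_notMem hs, Set.indicator_of_mem ht] at key
  exact hω.ne key

/-- The conditional entropy of `A` given `B` vanishes iff `B` determines `A` on the support. -/
lemma condEnt_eq_zero_iff (hP : ∀ ω, 0 ≤ P ω) (A : Ω → α) (B : Ω → β) :
    condEnt P A B = 0 ↔ ∀ ω ω', 0 < P ω → 0 < P ω' → B ω' = B ω → A ω' = A ω := by
  have hsub : ∀ ω, {ω' | A ω' = A ω ∧ B ω' = B ω} ⊆ {ω' | B ω' = B ω} := fun _ _ h => h.2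
  constructor
  · intro h ω ω' hω hω' hB
    have hnonpos : ∀ i ∈ Finset.univ, P i * Real.log
        (pr P {ω' | A ω' = A i ∧ B ω' = B i} / pr P {ω' | B ω' = B i}) ≤ 0 := fun i _ => by
      rcases (hP i).eq_or_lt with hi | hi
      · simp [← hi]
      · have hb : 0 < pr P {ω' | B ω' = B i} := pr_pos hP rfl hi
        have ha : 0 < pr P {ω' | A ω' = A i ∧ B ω' = B i} := pr_pos hP ⟨rfl, rfl⟩ hi
        exact mul_nonpos_of_nonneg_of_nonpos hi.le
          (Real.log_nonpos (by positivity) ((div_le_one hb).2 (pr_mono hP (hsub i))))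
    have hzero := (Finset.sum_eq_zero_iff_of_nonpos hnonpos).1 (neg_eq_zero.1 h) ω
      (Finset.mem_univ ω)
    have hb : 0 < pr P {ω' | B ω' = B ω} := pr_pos hP rfl hω
    have ha : 0 < pr P {ω' | A ω' = A ω ∧ B ω' = B ω} := pr_pos hP ⟨rfl, rfl⟩ hω
    have hlog := (mul_eq_zero.1 hzero).resolve_left hω.ne'
    have hdiv := Real.eq_one_of_pos_of_log_eq_zero (div_pos ha hb) hlog
    have heq := (div_eq_one_iff_eq hb.ne').1 hdiv
    exact (mem_of_pr_eq hP (hsub ω) heq hω' hB).1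
  · intro h
    refine neg_eq_zero.2 (Finset.sum_eq_zero fun ω _ => ?_)
    rcases (hP ω).eq_or_lt with hω | hω
    · simp [← hω]
    · have hb : 0 < pr P {ω' | B ω' = B ω} := pr_pos hP rfl hω
      have heq : pr P {ω' | A ω' = A ω ∧ B ω' = B ω} = pr P {ω' | B ω' = B ω} :=
        pr_congr fun ω' hω' =>
          ⟨fun h' => h'.2, fun h' => ⟨h ω ω' hω ((hP ω').lt_of_ne' hω') h', h'⟩⟩
      rw [heq, div_self hb.ne', Real.log_one, mul_zero]

lemma mi_eq_ent_sub_condEnt (hP : ∀ ω, 0 ≤ P ω) (A : Ω → α) (B : Ω → β) :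
    mi P A B = ent P A - condEnt P A B := by
  rw [mi, ent, condEnt, sub_neg_eq_add, neg_add_eq_sub, ← Finset.sum_sub_distrib]
  refine Finset.sum_congr rfl fun ω _ => ?_
  rcases (hP ω).eq_or_lt with hω | hω
  · simp [← hω]
  · have hab : 0 < pr P {ω' | A ω' = A ω ∧ B ω' = B ω} := pr_pos hP ⟨rfl, rfl⟩ hω
    have ha : 0 < pr P {ω' | A ω' = A ω} := pr_pos hP rfl hω
    have hb : 0 < pr P {ω' | B ω' = B ω} := pr_pos hP rfl hω
    rw [Real.log_div hab.ne' (mul_pos ha hb).ne', Real.log_mul ha.ne' hb.ne',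
      Real.log_div hab.ne' hb.ne']
    ring

lemma mi_comm (A : Ω → α) (B : Ω → β) : mi P A B = mi P B A := by
  refine Finset.sum_congr rfl fun ω _ => ?_
  simp only [and_comm, mul_comm]

end Entropy

/-- Let `P` be noiseless, with `𝒳₊ = {x : P_X(x) > 0, P(Y=1|X=x) = 1}` and
`𝒳₋ = {x : P_X(x) > 0, P(Y=-1|X=x) = 1}`. If `f : 𝒳 → [-1,1]` is a lossless maximal
compressor of `P` then there are `s₊ ≠ s₋` in `[-1,1]` with `f ≡ s₊` on `𝒳₊` and
`f ≡ s₋` on `𝒳₋`. -/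
theorem lmc_two_valued_on_support {𝒳 : Type*} [Fintype 𝒳]
    (P : 𝒳 × Ybin → ℝ) (hP0 : ∀ ω, 0 ≤ P ω) (hP1 : ∑ ω, P ω = 1)
    (hnoiseless : condEnt P (fun ω => ω.2) (fun ω => ω.1) = 0)
    (f : 𝒳 → ℝ) (hf : ∀ x, f x ∈ Set.Icc (-1 : ℝ) 1)
    (hcomp : mi P (fun ω => f ω.1) (fun ω => ω.1) = mi P (fun ω => f ω.1) (fun ω => ω.2))
    (hloss : mi P (fun ω => f ω.1) (fun ω => ω.2) = mi P (fun ω => ω.1) (fun ω => ω.2)) :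
    ∃ sp sm : ℝ, sp ∈ Set.Icc (-1 : ℝ) 1 ∧ sm ∈ Set.Icc (-1 : ℝ) 1 ∧ sp ≠ sm ∧
      (∀ x : 𝒳, 0 < margX P x → P (x, yPos) / margX P x = 1 → f x = sp) ∧
      (∀ x : 𝒳, 0 < margX P x → P (x, yNeg) / margX P x = 1 → f x = sm) := by
  have hFX := mi_eq_ent_sub_condEnt hP0 (fun ω => f ω.1) (fun ω => ω.1)
  rw [(condEnt_eq_zero_iff hP0 _ _).2 fun _ _ _ _ h => congrArg f h] at hFX
  have hYX := mi_eq_ent_sub_condEnt hP0 (fun ω => ω.2) (fun ω => ω.1)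
  rw [hnoiseless, mi_comm] at hYX
  have hFY := mi_eq_ent_sub_condEnt hP0 (fun ω => f ω.1) (fun ω => ω.2)
  have hYF := mi_eq_ent_sub_condEnt hP0 (fun ω => ω.2) (fun ω => f ω.1)
  rw [mi_comm] at hYF
  have hF_of_Y := (condEnt_eq_zero_iff hP0 (fun ω => f ω.1) (fun ω => ω.2)).1 (by linarith)
  have hY_of_F := (condEnt_eq_zero_iff hP0 (fun ω => ω.2) (fun ω => f ω.1)).1 (by linarith)
  have hpos : ∀ x y, 0 < margX P x → P (x, y) / margX P x = 1 → 0 < P (x, y) :=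
    fun x y hx h => by rwa [(div_eq_one_iff_eq hx.ne').1 h]
  have hexists_ne : ∀ s : ℝ, ∃ t ∈ Set.Icc (-1 : ℝ) 1, t ≠ s := fun s => by
    by_cases hs : s = 0
    · exact ⟨1, by norm_num, by simp [hs]⟩
    · exact ⟨0, by norm_num, Ne.symm hs⟩
  by_cases hp : ∃ x, 0 < P (x, yPos)
  · obtain ⟨a, ha⟩ := hp
    by_cases hm : ∃ x, 0 < P (x, yNeg)
    · obtain ⟨b, hb⟩ := hm
      refine ⟨f a, f b, hf a, hf b, fun hab => ?_,
        fun x hx h => hF_of_Y (a, yPos) (x, yPos) ha (hpos x _ hx h) rfl,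
        fun x hx h => hF_of_Y (b, yNeg) (x, yNeg) hb (hpos x _ hx h) rfl⟩
      exact absurd (hY_of_F (b, yNeg) (a, yPos) hb ha hab) (show yPos ≠ yNeg by decide)
    · obtain ⟨t, ht, hne⟩ := hexists_ne (f a)
      exact ⟨f a, t, hf a, ht, hne.symm,
        fun x hx h => hF_of_Y (a, yPos) (x, yPos) ha (hpos x _ hx h) rfl,
        fun x hx h => absurd ⟨x, hpos x _ hx h⟩ hm⟩
  · obtain ⟨s, hs, hsm⟩ : ∃ s ∈ Set.Icc (-1 : ℝ) 1, ∀ x, 0 < P (x, yNeg) → f x = s := by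
      by_cases hm : ∃ x, 0 < P (x, yNeg)
      · obtain ⟨b, hb⟩ := hm
        exact ⟨f b, hf b, fun x hx => hF_of_Y (b, yNeg) (x, yNeg) hb hx rfl⟩
      · exact ⟨0, by norm_num, fun x hx => absurd ⟨x, hx⟩ hm⟩
    obtain ⟨t, ht, hne⟩ := hexists_ne s
    exact ⟨t, s, ht, hs, hne, fun x hx h => absurd ⟨x, hpos x _ hx h⟩ hp,
      fun x hx h => hsm x (hpos x _ hx h)⟩
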